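/- arXiv:1802.10303 — 2 statements merged into one kernel-verified Lean document; each statement's English description precedes it below -/
import Mathlib

section
/- Let d be a positive integer, D a finite set of points in ℝ^d, and k an integer with 1 ≤ k ≤ |D|. The minimum cardinality of a subset X ⊆ D with rank-regret at most k for the class of nonnegative linear ranking functions equals the minimum cardinality of a subset X ⊆ D that intersects every k-set of D. (The one-to-one mapping between the rank-regret representative problem and the minimum geometric hitting set problem over the collection of k-sets.) -/
open scoped Classical

/-- Dot-product score of point `s` under weight vector `w`. -/
noncomputable def dotp {d : ℕ} (w s : Fin d → ℝ) : ℝ := ∑ i, w i * s i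

/-- `rankOf D w t = 1 + |{s ∈ D : ⟨w,s⟩ > ⟨w,t⟩}|`. -/
noncomputable def rankOf {d : ℕ} (D : Finset (Fin d → ℝ)) (w t : Fin d → ℝ) : ℕ :=
  1 + (D.filter (fun s => dotp w s > dotp w t)).card

/-- `S` is a `k`-set of `D`. -/
noncomputable def IsKSet {d : ℕ} (D : Finset (Fin d → ℝ)) (k : ℕ)
    (S : Finset (Fin d → ℝ)) : Prop :=
  S ⊆ D ∧ S.card = k ∧
    ∃ (v : Fin d → ℝ) (c : ℝ), v ≠ 0 ∧ (∀ i, 0 ≤ v i) ∧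
      (∀ p ∈ S, dotp v p > c) ∧ (∀ p ∈ D \ S, dotp v p < c)

/-- `X` has rank-regret at most `k` for the class of nonnegative linear ranking functions. -/
noncomputable def HasRankRegretAtMost {d : ℕ} (D : Finset (Fin d → ℝ)) (k : ℕ)
    (X : Finset (Fin d → ℝ)) : Prop :=
  ∀ w : Fin d → ℝ, w ≠ 0 → (∀ i, 0 ≤ w i) → ∃ t ∈ X, rankOf D w t ≤ k

/-- A finite set on which `f` is injective splits, for each admissible size `k`, into its `k` largest
elements with respect to `f` and the rest. -/
theorem exists_top_subset {α : Type*} [DecidableEq α] (D : Finset α) (f : α → ℝ)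
    (hf : ∀ p ∈ D, ∀ q ∈ D, p ≠ q → f p ≠ f q) (k : ℕ) (hk : k ≤ D.card) :
    ∃ S ⊆ D, S.card = k ∧ ∀ p ∈ S, ∀ q ∈ D \ S, f q < f p := by
  induction k with
  | zero => exact ⟨∅, by simp, by simp, by simp⟩
  | succ k ih =>
    obtain ⟨S, hSD, hcard, hS⟩ := ih (by omega)
    have hne : (D \ S).Nonempty := by
      rw [← Finset.card_pos, Finset.card_sdiff_of_subset hSD]
      omega
    obtain ⟨m, hm, hmax⟩ := Finset.exists_max_image (D \ S) f hne
    have hmD := (Finset.mem_sdiff.1 hm).1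
    have hmS := (Finset.mem_sdiff.1 hm).2
    refine ⟨insert m S, Finset.insert_subset hmD hSD, by
      rw [Finset.card_insert_of_notMem hmS, hcard], ?_⟩
    intro p hp q hq
    obtain ⟨hqD, hq'⟩ := Finset.mem_sdiff.1 hq
    rw [Finset.mem_insert, not_or] at hq'
    have hqS : q ∈ D \ S := Finset.mem_sdiff.2 ⟨hqD, hq'.2⟩
    rcases Finset.mem_insert.1 hp with rfl | hp
    · exact lt_of_le_of_ne (hmax q hqS) (hf q hqD p hmD hq'.1)
    · exact hS p hp q hqS

/-- The moment-curve perturbation of `w` with parameter `ε`. -/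
def perturb {d : ℕ} (w : Fin d → ℝ) (ε : ℝ) : Fin d → ℝ := fun i => w i + ε ^ ((i : ℕ) + 1)

theorem continuous_dotp_perturb {d : ℕ} (w p : Fin d → ℝ) :
    Continuous fun ε => dotp (perturb w ε) p := by
  unfold dotp perturb
  fun_prop

theorem dotp_perturb_zero {d : ℕ} (w p : Fin d → ℝ) : dotp (perturb w 0) p = dotp w p := by
  simp [dotp, perturb]

open scoped Topology

theorem eventually_dotp_perturb_ne {d : ℕ} (w : Fin d → ℝ) {p q : Fin d → ℝ} (hpq : p ≠ q) :
    ∀ᶠ ε in 𝓝[>] (0 : ℝ), dotp (perturb w ε) p ≠ dotp (perturb w ε) q := by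
  let P : Polynomial ℝ := Polynomial.C (dotp w p - dotp w q) +
    ∑ i : Fin d, Polynomial.C (p i - q i) * Polynomial.X ^ ((i : ℕ) + 1)
  have hP : P ≠ 0 := by
    obtain ⟨j, hj⟩ := Function.ne_iff.1 hpq
    intro h
    have hc := congrArg (fun R => Polynomial.coeff R ((j : ℕ) + 1)) h
    simp only [P, Polynomial.coeff_add, Polynomial.finsetSum_coeff, Polynomial.coeff_C_mul_X_pow,
      Polynomial.coeff_C_succ, zero_add, Polynomial.coeff_zero, Nat.add_right_cancel_iff,
      Fin.val_inj, Finset.sum_ite_eq, Finset.mem_univ, if_true] at hc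
    exact hj (sub_eq_zero.1 hc)
  have heval : ∀ ε, P.eval ε = dotp (perturb w ε) p - dotp (perturb w ε) q := by
    intro ε
    simp only [P, dotp, perturb, Polynomial.eval_add, Polynomial.eval_C, Polynomial.eval_finsetSum,
      Polynomial.eval_mul, Polynomial.eval_pow, Polynomial.eval_X, ← Finset.sum_sub_distrib,
      ← Finset.sum_add_distrib]
    exact Finset.sum_congr rfl fun i _ => by ring
  have hfin : (P.rootSet ℝ \ {0}).Finite := (P.rootSet_finite ℝ).subset Set.sdiff_subset
  have hev : ∀ᶠ ε in 𝓝 (0 : ℝ), ε ∈ (P.rootSet ℝ \ {0})ᶜ :=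
    hfin.isClosed.isOpen_compl.mem_nhds (by simp)
  filter_upwards [nhdsWithin_le_nhds hev, self_mem_nhdsWithin] with ε hε hpos h
  refine hε ⟨?_, ne_of_gt hpos⟩
  rw [Polynomial.mem_rootSet]
  refine ⟨hP, ?_⟩
  rw [Polynomial.coe_aeval_eq_eval, heval, h, sub_self]

/-- Every nonnegative weight vector can be replaced by a nonnegative one that breaks all ties on `D`
and preserves all strict comparisons on `D`. -/
theorem exists_tie_breaking {d : ℕ} (D : Finset (Fin d → ℝ)) (w : Fin d → ℝ) (hw : w ≠ 0)
    (hw0 : ∀ i, 0 ≤ w i) :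
    ∃ v : Fin d → ℝ, v ≠ 0 ∧ (∀ i, 0 ≤ v i) ∧
      (∀ p ∈ D, ∀ q ∈ D, p ≠ q → dotp v p ≠ dotp v q) ∧
      (∀ p ∈ D, ∀ q ∈ D, dotp w p < dotp w q → dotp v p < dotp v q) := by
  have hne : ∀ᶠ ε in 𝓝[>] (0 : ℝ), ∀ p ∈ D, ∀ q ∈ D, p ≠ q →
      dotp (perturb w ε) p ≠ dotp (perturb w ε) q := by
    simp only [Filter.eventually_all_finset, Filter.eventually_imp_distrib_left]
    exact fun p _ q _ h => eventually_dotp_perturb_ne w h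
  have hlt : ∀ᶠ ε in 𝓝[>] (0 : ℝ), ∀ p ∈ D, ∀ q ∈ D, dotp w p < dotp w q →
      dotp (perturb w ε) p < dotp (perturb w ε) q := by
    simp only [Filter.eventually_all_finset, Filter.eventually_imp_distrib_left]
    intro p _ q _ h
    refine nhdsWithin_le_nhds ?_
    exact (continuous_dotp_perturb w p).continuousAt.eventually_lt
      (continuous_dotp_perturb w q).continuousAt (by simpa only [dotp_perturb_zero] using h)
  obtain ⟨ε, ⟨h1, h2⟩, hε⟩ := ((hne.and hlt).and self_mem_nhdsWithin).exists
  have hε : 0 < ε := hε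
  obtain ⟨j, -⟩ := Function.ne_iff.1 hw
  have hpos : ∀ i, 0 < perturb w ε i := fun i => add_pos_of_nonneg_of_pos (hw0 i) (pow_pos hε _)
  exact ⟨perturb w ε, fun h => (hpos j).ne' (congrFun h j), fun i => (hpos i).le, h1, h2⟩

theorem hasRankRegretAtMost_iff_hits_kSets {d : ℕ} {D X : Finset (Fin d → ℝ)} {k : ℕ}
    (hk : k ≤ D.card) (hX : X ⊆ D) :
    HasRankRegretAtMost D k X ↔
      ∀ S : Finset (Fin d → ℝ), IsKSet D k S → (X ∩ S).Nonempty := by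
  constructor
  · rintro h S ⟨hSD, hcard, v, c, hv, hv0, hin, hout⟩
    obtain ⟨t, htX, ht⟩ := h v hv hv0
    refine ⟨t, Finset.mem_inter.2 ⟨htX, ?_⟩⟩
    by_contra htS
    have htc := hout t (Finset.mem_sdiff.2 ⟨hX htX, htS⟩)
    have hsub : S ⊆ D.filter (fun s => dotp v s > dotp v t) := fun s hs =>
      Finset.mem_filter.2 ⟨hSD hs, htc.trans (hin s hs)⟩
    have := Finset.card_le_card hsub
    unfold rankOf at ht
    omega
  · intro h w hw hw0
    obtain ⟨v, hv, hv0, hinj, hmono⟩ := exists_tie_breaking D w hw hw0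
    obtain ⟨S, hSD, hcard, hS⟩ := exists_top_subset D (dotp v) hinj k hk
    obtain ⟨c, hlo, hhi⟩ := Order.exists_between_finsets ((D \ S).image (dotp v))
      (S.image (dotp v)) (by
        intro x hx y hy
        obtain ⟨q, hq, rfl⟩ := Finset.mem_image.1 hx
        obtain ⟨p, hp, rfl⟩ := Finset.mem_image.1 hy
        exact hS p hp q hq)
    obtain ⟨t, ht⟩ := h S ⟨hSD, hcard, v, c, hv, hv0,
      fun p hp => hhi _ (Finset.mem_image_of_mem _ hp),
      fun p hp => hlo _ (Finset.mem_image_of_mem _ hp)⟩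
    obtain ⟨htX, htS⟩ := Finset.mem_inter.1 ht
    refine ⟨t, htX, ?_⟩
    have hsub : D.filter (fun s => dotp w s > dotp w t) ⊆ S.erase t := by
      intro s hs
      obtain ⟨hsD, hst⟩ := Finset.mem_filter.1 hs
      have hlt := hmono t (hSD htS) s hsD hst
      refine Finset.mem_erase.2 ⟨fun e => hlt.ne (by rw [e]), ?_⟩
      by_contra hsS
      exact (hS t htS s (Finset.mem_sdiff.2 ⟨hsD, hsS⟩)).not_gt hlt
    have hle := Finset.card_le_card hsub
    rw [Finset.card_erase_of_mem htS] at hle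
    have := Finset.card_pos.2 ⟨t, htS⟩
    unfold rankOf
    omega

theorem stmt_8 {d : ℕ} (hd : 0 < d) (D : Finset (Fin d → ℝ)) (k : ℕ)
    (hk1 : 1 ≤ k) (hk2 : k ≤ D.card) :
    sInf {n : ℕ | ∃ X : Finset (Fin d → ℝ), X ⊆ D ∧ X.card = n ∧ HasRankRegretAtMost D k X} =
    sInf {n : ℕ | ∃ X : Finset (Fin d → ℝ), X ⊆ D ∧ X.card = n ∧
      ∀ S : Finset (Fin d → ℝ), IsKSet D k S → (X ∩ S).Nonempty} := by
  congr 1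
  ext n
  exact exists_congr fun X => and_congr_right fun hX => and_congr_right fun _ =>
    hasRankRegretAtMost_iff_hits_kSets hk2 hX
end

section
/- Let D be a finite set of points in ℝ² and k a positive integer. For θ ∈ [0, π/2] write w(θ) = (cos θ, sin θ), for t ∈ D let Θ_t = {θ ∈ [0, π/2] : rank_{w(θ)}(t) ≤ k}, and for t with Θ_t ≠ ∅ let I_t = [min Θ_t, max Θ_t] (these exist since Θ_t is closed and bounded). If X ⊆ D is such that [0, π/2] ⊆ ⋃_{t ∈ X, Θ_t ≠ ∅} I_t, then for every nonzero w ∈ ℝ² with nonnegative coordinates there exists t ∈ X with rank_w(t) ≤ 2k. (Theorem on the 2DRRR output: a set of items whose angle-intervals cover the function space has rank-regret at most 2k.) -/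
open scoped Classical

/-- The unit weight vector `(cos θ, sin θ)` in the plane. -/
noncomputable def wvec (θ : ℝ) : Fin 2 → ℝ := ![Real.cos θ, Real.sin θ]

/-- The set of angles `θ ∈ [0, π/2]` for which `t` is in the top-`k` of `D` under `w(θ)`. -/
noncomputable def Theta (D : Finset (Fin 2 → ℝ)) (k : ℕ) (t : Fin 2 → ℝ) : Set ℝ :=
  {θ : ℝ | θ ∈ Set.Icc 0 (Real.pi / 2) ∧ rankOf D (wvec θ) t ≤ k}

/-- The interval `I_t = [min Θ_t, max Θ_t]` (meaningful when `Θ_t` is nonempty). -/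
noncomputable def Ivl (D : Finset (Fin 2 → ℝ)) (k : ℕ) (t : Fin 2 → ℝ) : Set ℝ :=
  Set.Icc (sInf (Theta D k t)) (sSup (Theta D k t))

lemma dotp_wvec (θ : ℝ) (s : Fin 2 → ℝ) :
    dotp (wvec θ) s = Real.cos θ * s 0 + Real.sin θ * s 1 := by
  simp [dotp, wvec, Fin.sum_univ_two]

lemma continuous_dotp_wvec (s : Fin 2 → ℝ) : Continuous fun θ => dotp (wvec θ) s := by
  simp only [dotp_wvec]
  fun_prop

/-- The rank of a point is lower semicontinuous in the angle, so its top-`k` angles are closed. -/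
lemma isClosed_setOf_rankOf_le (D : Finset (Fin 2 → ℝ)) (k : ℕ) (t : Fin 2 → ℝ) :
    IsClosed {θ : ℝ | rankOf D (wvec θ) t ≤ k} := by
  rw [← isOpen_compl_iff, isOpen_iff_mem_nhds]
  intro θ₀ hθ₀
  have hev : ∀ᶠ θ in nhds θ₀, ∀ s ∈ D.filter (fun s => dotp (wvec θ₀) s > dotp (wvec θ₀) t),
      dotp (wvec θ) t < dotp (wvec θ) s := by
    rw [Filter.eventually_all_finset]
    intro s hs
    exact (continuous_dotp_wvec t).continuousAt.eventually_lt
      (continuous_dotp_wvec s).continuousAt (Finset.mem_filter.mp hs).2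
  filter_upwards [hev] with θ hθ
  simp only [Set.mem_compl_iff, Set.mem_ofPred_eq, not_le] at hθ₀ ⊢
  refine hθ₀.trans_le (Nat.add_le_add_left (Finset.card_le_card fun s hs => ?_) 1)
  exact Finset.mem_filter.mpr ⟨(Finset.mem_filter.mp hs).1, hθ s hs⟩

lemma isCompact_Theta (D : Finset (Fin 2 → ℝ)) (k : ℕ) (t : Fin 2 → ℝ) :
    IsCompact (Theta D k t) :=
  isCompact_Icc.inter_right (isClosed_setOf_rankOf_le D k t)

/-- A point scoring above `t` at an intermediate angle does so at one of the extreme angles. -/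
lemma dotp_wvec_lt_or_lt {a b θ : ℝ} (ha : 0 ≤ a) (hb : b ≤ Real.pi / 2) (haθ : a ≤ θ)
    (hθb : θ ≤ b) {s t : Fin 2 → ℝ} (h : dotp (wvec θ) t < dotp (wvec θ) s) :
    dotp (wvec a) t < dotp (wvec a) s ∨ dotp (wvec b) t < dotp (wvec b) s := by
  have hpi := Real.pi_pos
  rcases haθ.eq_or_lt with rfl | hlt
  · exact Or.inl h
  by_contra! hcon
  obtain ⟨h₁, h₂⟩ := hcon
  have hab : 0 < Real.sin (b - a) := Real.sin_pos_of_pos_of_lt_pi (by linarith) (by linarith)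
  have hbθ : 0 ≤ Real.sin (b - θ) :=
    Real.sin_nonneg_of_nonneg_of_le_pi (by linarith) (by linarith)
  have hθa : 0 ≤ Real.sin (θ - a) :=
    Real.sin_nonneg_of_nonneg_of_le_pi (by linarith) (by linarith)
  have key (x : Fin 2 → ℝ) : Real.sin (b - a) * dotp (wvec θ) x =
      Real.sin (b - θ) * dotp (wvec a) x + Real.sin (θ - a) * dotp (wvec b) x := by
    simp only [dotp_wvec, Real.sin_sub]
    ring
  have hmul := mul_lt_mul_of_pos_left h hab
  rw [key, key] at hmul
  linarith [mul_le_mul_of_nonneg_left h₁ hbθ, mul_le_mul_of_nonneg_left h₂ hθa]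

lemma rankOf_wvec_add_one_le (D : Finset (Fin 2 → ℝ)) {a b θ : ℝ} (ha : 0 ≤ a)
    (hb : b ≤ Real.pi / 2) (haθ : a ≤ θ) (hθb : θ ≤ b) (t : Fin 2 → ℝ) :
    rankOf D (wvec θ) t + 1 ≤ rankOf D (wvec a) t + rankOf D (wvec b) t := by
  have hsub : D.filter (fun s => dotp (wvec θ) s > dotp (wvec θ) t) ⊆
      D.filter (fun s => dotp (wvec a) s > dotp (wvec a) t) ∪
        D.filter (fun s => dotp (wvec b) s > dotp (wvec b) t) := by
    intro s hs
    rw [← Finset.filter_or]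
    obtain ⟨hsD, hlt⟩ := Finset.mem_filter.mp hs
    exact Finset.mem_filter.mpr ⟨hsD, dotp_wvec_lt_or_lt ha hb haθ hθb hlt⟩
  have hcard := (Finset.card_le_card hsub).trans (Finset.card_union_le _ _)
  simp only [rankOf]
  omega

lemma rankOf_smul {d : ℕ} (D : Finset (Fin d → ℝ)) {r : ℝ} (hr : 0 < r) (w t : Fin d → ℝ) :
    rankOf D (r • w) t = rankOf D w t := by
  have hdotp (s : Fin d → ℝ) : dotp (r • w) s = r * dotp w s := by
    simp [dotp, Finset.mul_sum, mul_assoc]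
  simp [rankOf, hdotp, mul_lt_mul_iff_right₀ hr]

lemma exists_eq_smul_wvec {w : Fin 2 → ℝ} (hw : w ≠ 0) (hnn : ∀ i, 0 ≤ w i) :
    ∃ r : ℝ, 0 < r ∧ ∃ θ ∈ Set.Icc 0 (Real.pi / 2), w = r • wvec θ := by
  let z : ℂ := ⟨w 0, w 1⟩
  have hz : z ≠ 0 := by
    intro h
    apply hw
    funext i
    fin_cases i
    · exact congrArg Complex.re h
    · exact congrArg Complex.im h
  refine ⟨‖z‖, norm_pos_iff.mpr hz, z.arg, ⟨Complex.arg_nonneg_iff.mpr (hnn 1),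
    (abs_le.mp (Complex.abs_arg_le_pi_div_two_iff.mpr (hnn 0))).2⟩, ?_⟩
  funext i
  fin_cases i
  · exact (Complex.norm_mul_cos_arg z).symm
  · exact (Complex.norm_mul_sin_arg z).symm

theorem stmt_13 (D : Finset (Fin 2 → ℝ)) (k : ℕ) (hk : 0 < k)
    (X : Finset (Fin 2 → ℝ)) (hX : X ⊆ D)
    (hcov : Set.Icc 0 (Real.pi / 2) ⊆
      ⋃ t ∈ X, ⋃ (_ : (Theta D k t).Nonempty), Ivl D k t) :
    ∀ w : Fin 2 → ℝ, w ≠ 0 → (∀ i, 0 ≤ w i) → ∃ t ∈ X, rankOf D w t ≤ 2 * k := by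
  intro w hw hnn
  obtain ⟨r, hr, θ, hθ, rfl⟩ := exists_eq_smul_wvec hw hnn
  have hθX := hcov hθ
  simp only [Set.mem_iUnion] at hθX
  obtain ⟨t, htX, hne, hmin, hmax⟩ := hθX
  obtain ⟨hInf, hInfk⟩ := (isCompact_Theta D k t).sInf_mem hne
  obtain ⟨hSup, hSupk⟩ := (isCompact_Theta D k t).sSup_mem hne
  refine ⟨t, htX, ?_⟩
  rw [rankOf_smul D hr]
  have := rankOf_wvec_add_one_le D hInf.1 hSup.2 hmin hmax t
  omega
end
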